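/- arXiv:1503.06607 — 2 statements merged into one kernel-verified Lean document; each statement's English description precedes it below -/
import Mathlib

section
/- Let (x,y) ∈ D(π/4) with x > 0, let λ = y/x, and let λ₀ = ((2−3√2)·√(4√2+7) + 5√2 + 6)/14. Then sup{ ‖DP_t(x,y)‖ : t ∈ [−1,1] } equals: √2·((1+2√2)·x − (3+2√2)·y) if 0 ≤ λ < λ₀; 2·(x + y²/(x−y)) if λ₀ ≤ λ < 2−√2; and 4·(1+√2)·y − 2x if 2−√2 ≤ λ ≤ 1. -/
open Real Set

noncomputable section

/-- The sector D(π/4): points (x,y) with 0 ≤ y ≤ x and x² + y² ≤ 1. -/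
def sector : Set (ℝ × ℝ) := {p | 0 ≤ p.2 ∧ p.2 ≤ p.1 ∧ p.1 ^ 2 + p.2 ^ 2 ≤ 1}

/-- The supremum norm of the 2-homogeneous polynomial a·x² + b·y² + c·x·y over the sector. -/
def secNorm (a b c : ℝ) : ℝ :=
  sSup ((fun p : ℝ × ℝ => |a * p.1 ^ 2 + b * p.2 ^ 2 + c * p.1 * p.2|) '' sector)

/-- The sup over the sector of the differential of P_{a,b,c} at (x,y). -/
def diffNorm (a b c x y : ℝ) : ℝ :=
  sSup ((fun q : ℝ × ℝ => |(2 * a * x + c * y) * q.1 + (2 * b * y + c * x) * q.2|) '' sector)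

/-- The sector lies in the quadrilateral with vertices `(0,0)`, `(1,0)`, `(1,√2-1)`,
`(1/√2,1/√2)`, so a linear form is bounded on it by its values at these vertices. -/
lemma linear_form_le_of_vertices {A B G u v : ℝ} (h₁ : A ≤ G) (h₂ : A + (√2 - 1) * B ≤ G)
    (h₃ : A + B ≤ √2 * G) (hG : 0 ≤ G) (huv : (u, v) ∈ sector) : A * u + B * v ≤ G := by
  obtain ⟨hv, hvu, hn⟩ := huv
  simp only at hv hvu hn
  have hr : √2 ^ 2 = 2 := Real.sq_sqrt (by norm_num)
  have hr0 : (1.414 : ℝ) < √2 := Real.lt_sqrt_of_sq_lt (by norm_num)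
  have hr1 : √2 < 1.415 := (Real.sqrt_lt' (by norm_num)).2 (by norm_num)
  generalize √2 = r at *
  have hu1 : u ≤ 1 := by nlinarith
  rcases le_total ((1 + r) * v) u with h | h
  · have e : A * u + B * v = A * (u - (1 + r) * v) + (A + (r - 1) * B) * ((1 + r) * v) := by
      linear_combination (-B * v) * hr
    have h1 := mul_le_mul_of_nonneg_right h₁ (sub_nonneg.2 h)
    have h2 := mul_le_mul_of_nonneg_right h₂ (show 0 ≤ (1 + r) * v by positivity)
    nlinarith
  · have hs : u + v ≤ r := by
      apply le_of_sq_le_sq _ (by linarith)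
      nlinarith [sq_nonneg (u - v)]
    have h1 := mul_le_mul_of_nonneg_right h₂ (sub_nonneg.2 hvu)
    have h2 := mul_le_mul_of_nonneg_right h₃ (show 0 ≤ v - (r - 1) * u by nlinarith)
    have h3 := mul_le_mul_of_nonneg_left hs hG
    have e : (2 - r) * (A * u + B * v)
        = (A + (r - 1) * B) * (u - v) + (A + B) * (v - (r - 1) * u) := by ring
    have e2 : G * (u - v) + r * G * (v - (r - 1) * u) = (r - 1) * (G * (u + v)) := by
      linear_combination (-G * u) * hr
    have e3 : (r - 1) * (G * r) = (2 - r) * G := by linear_combination G * hr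
    have : (2 - r) * (A * u + B * v) ≤ (2 - r) * G := by
      nlinarith
    exact le_of_mul_le_mul_left this (by linarith)

lemma abs_linear_form_le_of_vertices {A B G u v : ℝ} (h₁ : |A| ≤ G)
    (h₂ : |A + (√2 - 1) * B| ≤ G) (h₃ : |A + B| ≤ √2 * G) (huv : (u, v) ∈ sector) :
    |A * u + B * v| ≤ G := by
  have hG : 0 ≤ G := (abs_nonneg _).trans h₁
  rw [abs_le] at *
  have := linear_form_le_of_vertices h₁.2 h₂.2 h₃.2 hG huv
  have := linear_form_le_of_vertices (A := -A) (B := -B) (by linarith) (by linarith)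
    (by linarith) hG huv
  constructor <;> linarith

lemma add_mul_nonneg_of_endpoints {x y a b k l : ℝ} (hkl : k < l) (hk : k * x ≤ y)
    (hl : y ≤ l * x) (h₁ : 0 ≤ a + k * b) (h₂ : 0 ≤ a + l * b) : 0 ≤ a * x + b * y := by
  have e : (l - k) * (a * x + b * y)
      = (l * x - y) * (a + k * b) + (y - k * x) * (a + l * b) := by ring
  have : 0 ≤ (l - k) * (a * x + b * y) := by
    rw [e]
    exact add_nonneg (mul_nonneg (by linarith) h₁) (mul_nonneg (by linarith) h₂)
  exact nonneg_of_mul_nonneg_right this (by linarith)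

/-- Half of the coefficient of `-u` in `DP_t(x,y)(u,v)`, where `t = s ^ 2 - 1`. -/
def coeffFst (x y s : ℝ) : ℝ := x + 2 * s * y - s ^ 2 * (x - y)

/-- Half of the coefficient of `-v` in `DP_t(x,y)(u,v)`, where `t = s ^ 2 - 1`. -/
def coeffSnd (x y s : ℝ) : ℝ := s ^ 2 * (x - y) + s * (2 * x - 4 * y) - 3 * y

lemma abs_coeff_form_le {x y s G u v : ℝ} (hy : 0 ≤ y) (hyx : y ≤ x) (hs : 0 ≤ s)
    (hs' : s ≤ √2) (hG : x ≤ G) (h₁ : coeffFst x y s ≤ G)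
    (h₂ : coeffFst x y s + (√2 - 1) * coeffSnd x y s ≤ G)
    (h₃ : (1 + 2 * √2) * x - (3 + 2 * √2) * y ≤ √2 * G) (h₄ : 3 * y - x ≤ √2 * G)
    (huv : (u, v) ∈ sector) :
    |coeffFst x y s * u + coeffSnd x y s * v| ≤ G := by
  have hr : √2 ^ 2 = 2 := Real.sq_sqrt (by norm_num)
  have hr0 : (1.414 : ℝ) < √2 := Real.lt_sqrt_of_sq_lt (by norm_num)
  have hr1 : √2 < 1.415 := (Real.sqrt_lt' (by norm_num)).2 (by norm_num)
  have hs2 : s ^ 2 ≤ 2 := by nlinarith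
  have hx : 0 ≤ x := hy.trans hyx
  apply abs_linear_form_le_of_vertices _ _ _ huv
  · rw [abs_le]
    refine ⟨?_, h₁⟩
    unfold coeffFst
    nlinarith [mul_nonneg hs hy, mul_nonneg (sq_nonneg s) hy]
  · rw [abs_le]
    refine ⟨?_, h₂⟩
    have : 0 ≤ (2 - s ^ 2 * (2 - √2) + 2 * (√2 - 1) * s) * x
        + (2 * s + s ^ 2 * (2 - √2) - (√2 - 1) * (4 * s + 3)) * y := by
      apply add_mul_nonneg_of_endpoints (k := 0) (l := 1) (by norm_num) (by linarith)
        (by linarith)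
      · nlinarith
      · nlinarith
    unfold coeffFst coeffSnd
    linarith
  · rw [abs_le]
    unfold coeffFst coeffSnd
    constructor
    · nlinarith [mul_nonneg hs (sub_nonneg.2 hyx)]
    · nlinarith [mul_nonneg (sub_nonneg.2 hs') (sub_nonneg.2 hyx)]

lemma mem_sector_one_zero : ((1 : ℝ), (0 : ℝ)) ∈ sector := by
  simp [sector]

lemma mem_sector_diag : (√2 / 2, √2 / 2) ∈ sector := by
  have hr : √2 ^ 2 = 2 := Real.sq_sqrt (by norm_num)
  refine ⟨by positivity, le_rfl, ?_⟩
  simp only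
  linarith

/-- The supremum of `diffNorm` over the family is `2 * G` as soon as `G` bounds the relevant
linear forms and is attained. -/
lemma sSup_diffNorm_eq {x y G : ℝ}
    (hle : ∀ s, 0 ≤ s → s ≤ √2 → ∀ u v, (u, v) ∈ sector →
      |coeffFst x y s * u + coeffSnd x y s * v| ≤ G)
    (hge : ∃ s, 0 ≤ s ∧ s ≤ √2 ∧ ∃ u v, (u, v) ∈ sector ∧
      coeffFst x y s * u + coeffSnd x y s * v = G) :
    sSup {r : ℝ | ∃ t ∈ Set.Icc (-1 : ℝ) 1,
        r = diffNorm t (4 + t + 4 * √(1 + t)) (-2 - 2 * t - 4 * √(1 + t)) x y} = 2 * G := by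
  have key : ∀ t s u v : ℝ, t = s ^ 2 - 1 →
      |(2 * t * x + (-2 - 2 * t - 4 * s) * y) * u
        + (2 * (4 + t + 4 * s) * y + (-2 - 2 * t - 4 * s) * x) * v|
      = 2 * |coeffFst x y s * u + coeffSnd x y s * v| := by
    rintro t s u v rfl
    rw [← abs_neg, ← abs_two, ← abs_mul, abs_two]
    congr 1
    unfold coeffFst coeffSnd
    ring
  have bound : ∀ t ∈ Set.Icc (-1 : ℝ) 1, ∀ q ∈ sector,
      |(2 * t * x + (-2 - 2 * t - 4 * √(1 + t)) * y) * q.1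
        + (2 * (4 + t + 4 * √(1 + t)) * y + (-2 - 2 * t - 4 * √(1 + t)) * x) * q.2|
      ≤ 2 * G := by
    rintro t ⟨ht, ht'⟩ ⟨u, v⟩ hq
    have hsq : √(1 + t) ^ 2 = 1 + t := Real.sq_sqrt (by linarith)
    rw [key t (√(1 + t)) u v (by linarith)]
    have := hle (√(1 + t)) (Real.sqrt_nonneg _) (Real.sqrt_le_sqrt (by linarith)) u v hq
    linarith
  have ub : ∀ t ∈ Set.Icc (-1 : ℝ) 1,
      diffNorm t (4 + t + 4 * √(1 + t)) (-2 - 2 * t - 4 * √(1 + t)) x y ≤ 2 * G := by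
    intro t ht
    apply csSup_le (Set.Nonempty.image _ ⟨_, mem_sector_one_zero⟩)
    rintro _ ⟨q, hq, rfl⟩
    exact bound t ht q hq
  apply IsGreatest.csSup_eq
  refine ⟨?_, ?_⟩
  · obtain ⟨s, hs, hs', u, v, huv, h⟩ := hge
    have hs2 : s ^ 2 ≤ 2 := by
      have : √2 ^ 2 = 2 := Real.sq_sqrt (by norm_num)
      nlinarith
    have ht : s ^ 2 - 1 ∈ Set.Icc (-1 : ℝ) 1 :=
      ⟨by linarith [sq_nonneg s], by linarith⟩
    refine ⟨s ^ 2 - 1, ht, le_antisymm ?_ (ub _ ht)⟩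
    have hsqrt : √(1 + (s ^ 2 - 1)) = s := by
      rw [add_sub_cancel, Real.sqrt_sq hs]
    apply le_csSup
    · refine ⟨2 * G, ?_⟩
      rintro _ ⟨q, hq, rfl⟩
      exact bound _ ht q hq
    · refine ⟨(u, v), huv, ?_⟩
      simp only [hsqrt]
      rw [key _ s u v rfl, h, abs_of_nonneg]
      exact (abs_nonneg _).trans (hle s hs hs' u v huv)
  · rintro _ ⟨t, ht, rfl⟩
    exact ub t ht

/-- The threshold `λ₀` is the smaller root of the quadratic comparing the values of `P_1` on the
diagonal with the maximum over `t` of the values on the first axis. -/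
lemma quadratic_eq_mul_roots (x y : ℝ) :
    (3 + √2) * y ^ 2 - (4 + 3 * √2) * x * y + (1 + √2) * x ^ 2
      = (3 + √2) * (((2 - 3 * √2) * √(4 * √2 + 7) + 5 * √2 + 6) / 14 * x - y)
        * ((-(2 - 3 * √2) * √(4 * √2 + 7) + 5 * √2 + 6) / 14 * x - y) := by
  have hr : √2 ^ 2 = 2 := Real.sq_sqrt (by norm_num)
  have hw : √(4 * √2 + 7) ^ 2 = 4 * √2 + 7 := Real.sq_sqrt (by positivity)
  generalize √(4 * √2 + 7) = w at *
  generalize √2 = r at *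
  have e1 : (3 + r) * ((5 * r + 6) / 7) = 4 + 3 * r := by linear_combination 5 / 7 * hr
  have e2 : (3 + r) * ((5 * r + 6) ^ 2 - (2 - 3 * r) ^ 2 * w ^ 2) = 196 * (1 + r) := by
    rw [hw]
    have h3 : r ^ 3 = 2 * r := by linear_combination r * hr
    have h4 : r ^ 4 = 4 := by linear_combination (r ^ 2 + 2) * hr
    ring_nf
    rw [h4, h3, hr]
    ring
  linear_combination x * y * e1 - x ^ 2 / 196 * e2

lemma mid_vertex_le_near_axis {x y s : ℝ} (hs : 0 ≤ s) (hs' : s ≤ √2)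
    (hy : 0 ≤ y) (h : y ≤ 0.37 * x) :
    coeffFst x y s + (√2 - 1) * coeffSnd x y s ≤ (√2 / 2 + 2) * x - (3 * √2 / 2 + 2) * y := by
  have hr : √2 ^ 2 = 2 := Real.sq_sqrt (by norm_num)
  have hr0 : (1.4142 : ℝ) < √2 := Real.lt_sqrt_of_sq_lt (by norm_num)
  have hr1 : √2 < 1.4143 := (Real.sqrt_lt' (by norm_num)).2 (by norm_num)
  have : 0 ≤ (√2 / 2 + 1 + s ^ 2 * (2 - √2) - 2 * (√2 - 1) * s) * x
      + (-(3 * √2 / 2) - 2 - 2 * s - s ^ 2 * (2 - √2) + (√2 - 1) * (4 * s + 3)) * y := by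
    apply add_mul_nonneg_of_endpoints (k := 0) (l := 0.37) (by norm_num) (by linarith)
      (by linarith)
    · nlinarith [sq_nonneg (s - 1)]
    · nlinarith [sq_nonneg (s - 1.25)]
  unfold coeffFst coeffSnd
  linarith

lemma mid_vertex_le_middle {x y s : ℝ} (hs : 0 ≤ s) (hs' : s ≤ √2)
    (h : 0.36 * x ≤ y) (h' : y ≤ 0.59 * x) :
    coeffFst x y s + (√2 - 1) * coeffSnd x y s ≤ (5 * x + 16 * y) / 9 := by
  have hr : √2 ^ 2 = 2 := Real.sq_sqrt (by norm_num)
  have hr0 : (1.4142 : ℝ) < √2 := Real.lt_sqrt_of_sq_lt (by norm_num)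
  have hr1 : √2 < 1.4143 := (Real.sqrt_lt' (by norm_num)).2 (by norm_num)
  have : 0 ≤ (-4 / 9 + s ^ 2 * (2 - √2) - 2 * (√2 - 1) * s) * x
      + (16 / 9 - 2 * s - s ^ 2 * (2 - √2) + (√2 - 1) * (4 * s + 3)) * y := by
    apply add_mul_nonneg_of_endpoints (k := 0.36) (l := 0.59) (by norm_num) (by linarith)
      (by linarith)
    · nlinarith [sq_nonneg (s - 1.25)]
    · nlinarith [sq_nonneg (s - 1.4)]
  unfold coeffFst coeffSnd
  linarith

lemma mid_vertex_le_near_diag {x y s : ℝ} (hs : 0 ≤ s) (hs' : s ≤ √2)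
    (h : 0.58 * x ≤ y) (hyx : y ≤ x) :
    coeffFst x y s + (√2 - 1) * coeffSnd x y s ≤ 2 * (1 + √2) * y - x := by
  have hr : √2 ^ 2 = 2 := Real.sq_sqrt (by norm_num)
  have hr0 : (1.4142 : ℝ) < √2 := Real.lt_sqrt_of_sq_lt (by norm_num)
  have hr1 : √2 < 1.4143 := (Real.sqrt_lt' (by norm_num)).2 (by norm_num)
  have : 0 ≤ (-2 + s ^ 2 * (2 - √2) - 2 * (√2 - 1) * s) * x
      + (2 * (1 + √2) - 2 * s - s ^ 2 * (2 - √2) + (√2 - 1) * (4 * s + 3)) * y := by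
    apply add_mul_nonneg_of_endpoints (k := 0.58) (l := 1) (by norm_num) (by linarith)
      (by linarith)
    · nlinarith [sq_nonneg (s - 1.4)]
    · nlinarith
  unfold coeffFst coeffSnd
  linarith

set_option maxHeartbeats 1000000 in
theorem stmt_15 (x y : ℝ) (hxy : (x, y) ∈ sector) (hx : 0 < x) :
    sSup {r : ℝ | ∃ t ∈ Set.Icc (-1 : ℝ) 1,
        r = diffNorm t (4 + t + 4 * Real.sqrt (1 + t)) (-2 - 2 * t - 4 * Real.sqrt (1 + t)) x y} =
      if y / x < ((2 - 3 * Real.sqrt 2) * Real.sqrt (4 * Real.sqrt 2 + 7)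
          + 5 * Real.sqrt 2 + 6) / 14 then
        Real.sqrt 2 * ((1 + 2 * Real.sqrt 2) * x - (3 + 2 * Real.sqrt 2) * y)
      else if y / x < 2 - Real.sqrt 2 then
        2 * (x + y ^ 2 / (x - y))
      else
        4 * (1 + Real.sqrt 2) * y - 2 * x := by
  obtain ⟨hy, hyx, -⟩ := hxy
  simp only at hy hyx
  have hr : √2 ^ 2 = 2 := Real.sq_sqrt (by norm_num)
  have hr0 : (1.4142 : ℝ) < √2 := Real.lt_sqrt_of_sq_lt (by norm_num)
  have hr1 : √2 < 1.4143 := (Real.sqrt_lt' (by norm_num)).2 (by norm_num)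
  have hw0 : (3.557 : ℝ) < √(4 * √2 + 7) := Real.lt_sqrt_of_sq_lt (by norm_num; linarith)
  have hw1 : √(4 * √2 + 7) < 3.558 := (Real.sqrt_lt' (by norm_num)).2 (by norm_num; linarith)
  have hq := quadratic_eq_mul_roots x y
  have hl0 : (0.36 : ℝ) < ((2 - 3 * √2) * √(4 * √2 + 7) + 5 * √2 + 6) / 14 := by nlinarith
  have hl1 : ((2 - 3 * √2) * √(4 * √2 + 7) + 5 * √2 + 6) / 14 < 0.37 := by nlinarith
  have hroot : 1 < (-(2 - 3 * √2) * √(4 * √2 + 7) + 5 * √2 + 6) / 14 := by nlinarith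
  have hfac : 0 ≤ (-(2 - 3 * √2) * √(4 * √2 + 7) + 5 * √2 + 6) / 14 * x - y := by nlinarith
  generalize ((2 - 3 * √2) * √(4 * √2 + 7) + 5 * √2 + 6) / 14 = l at *
  generalize (-(2 - 3 * √2) * √(4 * √2 + 7) + 5 * √2 + 6) / 14 = l' at *
  have hax : ∀ s, y < x → coeffFst x y s ≤ x + y ^ 2 / (x - y) := by
    intro s h
    have hd : 0 < x - y := sub_pos.2 h
    have : x + y ^ 2 / (x - y) - coeffFst x y s = (y - s * (x - y)) ^ 2 / (x - y) := by
      unfold coeffFst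
      field_simp
      ring
    have : 0 ≤ (y - s * (x - y)) ^ 2 / (x - y) := by positivity
    linarith
  have hcmp : y < x → √2 * (x + y ^ 2 / (x - y))
      = ((1 + 2 * √2) * x - (3 + 2 * √2) * y) - (3 + √2) * (l * x - y) * (l' * x - y) / (x - y) := by
    intro h
    have hd : x - y ≠ 0 := (sub_pos.2 h).ne'
    rw [← hq]
    field_simp
    ring
  split_ifs with h1 h2
  · rw [div_lt_iff₀ hx] at h1
    have hlt : y < x := by nlinarith
    have hd : 0 < x - y := sub_pos.2 hlt
    have hy37 : y ≤ 0.37 * x := by nlinarith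
    set G := √2 / 2 * ((1 + 2 * √2) * x - (3 + 2 * √2) * y) with hG
    have hrG : √2 * G = (1 + 2 * √2) * x - (3 + 2 * √2) * y := by
      rw [hG]
      linear_combination ((1 + 2 * √2) * x - (3 + 2 * √2) * y) / 2 * hr
    have hMG : x + y ^ 2 / (x - y) ≤ G := by
      have : 0 ≤ (3 + √2) * (l * x - y) * (l' * x - y) / (x - y) := by
        apply div_nonneg _ hd.le
        apply mul_nonneg (mul_nonneg (by positivity) (by linarith)) hfac
      have := hcmp hlt
      nlinarith
    have hxG : x ≤ G := by
      have : 0 ≤ y ^ 2 / (x - y) := by positivity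
      linarith
    have e : √2 * ((1 + 2 * √2) * x - (3 + 2 * √2) * y) = 2 * G := by rw [hG]; ring
    rw [e]
    apply sSup_diffNorm_eq
    · intro s hs hs' u v huv
      refine abs_coeff_form_le hy hyx hs hs' hxG ((hax s hlt).trans hMG) ?_ hrG.ge ?_ huv
      · have hG' : G = (√2 / 2 + 2) * x - (3 * √2 / 2 + 2) * y := by
          rw [hG]
          linear_combination (x - y) * hr
        rw [hG']
        exact mid_vertex_le_near_axis hs hs' hy hy37
      · nlinarith
    · refine ⟨√2, by positivity, le_rfl, _, _, mem_sector_diag, ?_⟩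
      rw [hG]
      unfold coeffFst coeffSnd
      ring
  · rw [not_lt, le_div_iff₀ hx] at h1
    rw [div_lt_iff₀ hx] at h2
    have hlt : y < x := by nlinarith
    have hd : 0 < x - y := sub_pos.2 hlt
    have hy36 : 0.36 * x ≤ y := by nlinarith
    have hy59 : y ≤ 0.59 * x := by nlinarith
    have hxG : x ≤ x + y ^ 2 / (x - y) := by
      have : 0 ≤ y ^ 2 / (x - y) := by positivity
      linarith
    have htan : (5 * x + 16 * y) / 9 ≤ x + y ^ 2 / (x - y) := by
      have : x + y ^ 2 / (x - y) - (5 * x + 16 * y) / 9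
          = (2 * x - 5 * y) ^ 2 / (9 * (x - y)) := by
        field_simp
        ring
      have : 0 ≤ (2 * x - 5 * y) ^ 2 / (9 * (x - y)) := by positivity
      linarith
    apply sSup_diffNorm_eq
    · intro s hs hs' u v huv
      refine abs_coeff_form_le hy hyx hs hs' hxG (hax s hlt) (le_trans ?_ htan) ?_ ?_ huv
      · exact mid_vertex_le_middle hs hs' hy36 hy59
      · rw [hcmp hlt]
        have : 0 ≤ (3 + √2) * (y - l * x) * (l' * x - y) / (x - y) := by
          apply div_nonneg _ hd.le
          apply mul_nonneg (mul_nonneg (by positivity) (by linarith)) hfac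
        have e : (3 + √2) * (l * x - y) * (l' * x - y) / (x - y)
          = -((3 + √2) * (y - l * x) * (l' * x - y) / (x - y)) := by ring
        linarith
      · nlinarith
    · refine ⟨y / (x - y), by positivity, ?_, 1, 0, mem_sector_one_zero, ?_⟩
      · rw [div_le_iff₀ hd]
        nlinarith
      · unfold coeffFst
        field_simp
        ring
  · rw [not_lt, le_div_iff₀ hx] at h2
    have hy58 : 0.58 * x ≤ y := by nlinarith
    have e : 4 * (1 + √2) * y - 2 * x = 2 * (2 * (1 + √2) * y - x) := by ring
    have hbal : √2 * x ≤ (1 + √2) * y := by nlinarith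
    rw [e]
    apply sSup_diffNorm_eq
    · intro s hs hs' u v huv
      refine abs_coeff_form_le hy hyx hs hs' ?_ ?_ ?_ ?_ ?_ huv
      · nlinarith
      · have : 2 * (1 + √2) * y - x - coeffFst x y s
            = (√2 - s) * (2 * y - (√2 + s) * (x - y)) := by
          unfold coeffFst
          linear_combination (x - y) * hr
        have : 0 ≤ (√2 - s) * (2 * y - (√2 + s) * (x - y)) :=
          mul_nonneg (by linarith) (by nlinarith)
        linarith
      · exact mid_vertex_le_near_diag hs hs' hy58 hyx
      · nlinarith
      · nlinarith
    · refine ⟨√2, by positivity, le_rfl, 1, 0, mem_sector_one_zero, ?_⟩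
      unfold coeffFst
      linear_combination (y - x) * hr
end
end

section
/- Let (x,y) ∈ D(π/4) with x > 0, let λ = y/x, and let λ₁ = ((4√2−5)·√(4√2+7) + 8 − 5√2)/7. Then sup{ ‖DQ_s(x,y)‖ : s ∈ [1, 5+4√2] } equals: √2·((1+2√2)·x − (3+2√2)·y) if 0 ≤ λ < (2√2−1)/7; √2·(x² + 3y²)/(2y) if (2√2−1)/7 ≤ λ < λ₁; and 4·(1+√2)·y − 2x if λ₁ ≤ λ ≤ 1. -/
open Real Set

noncomputable section

/-- The sector is contained in the convex hull of `(0,0)`, `(1,0)`, `(1,√2-1)` and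
`(1/√2,1/√2)`, so a linear form is bounded on it by its values at these points. -/
lemma abs_linear_le_of_mem_sector {r a b M : ℝ} (hr0 : 0 < r) (hr : r ^ 2 = 2) (ha : |a| ≤ M)
    (hc : |a + (r - 1) * b| ≤ M) (hd : |a + b| ≤ r * M) {p : ℝ × ℝ} (hp : p ∈ sector) :
    |a * p.1 + b * p.2| ≤ M := by
  obtain ⟨u, v⟩ := p
  obtain ⟨hv, hvu, huv⟩ := hp
  simp only at hv hvu huv ⊢
  have hr1 : 1 < r := by nlinarith
  have hr2 : r < 3 / 2 := by nlinarith
  have hM : 0 ≤ M := (abs_nonneg a).trans ha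
  have hu1 : u ≤ 1 := by nlinarith
  have hs : u + v ≤ r := by nlinarith [sq_nonneg (u - v)]
  rw [abs_le] at ha hc hd
  have key : ∀ a b : ℝ, a ≤ M → a + (r - 1) * b ≤ M → a + b ≤ r * M →
      a * u + b * v ≤ M := by
    intro a b ha hc hd
    by_cases h : v ≤ (r - 1) * u
    · have e : a * u + b * v
          = (u - (r + 1) * v) * a + (r + 1) * v * (a + (r - 1) * b) := by
        linear_combination (-b * v) * hr
      have h1 : 0 ≤ u - (r + 1) * v := by nlinarith
      have h2 : 0 ≤ (r + 1) * v := by positivity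
      rw [e]
      nlinarith [mul_le_mul_of_nonneg_left ha h1, mul_le_mul_of_nonneg_left hc h2,
        mul_le_mul_of_nonneg_right hu1 hM]
    · push Not at h
      have h1 : 0 ≤ u - v := by linarith
      have h2 : 0 ≤ v - (r - 1) * u := by linarith
      have i1 := mul_le_mul_of_nonneg_left hc h1
      have i2 := mul_le_mul_of_nonneg_left hd h2
      have e : (2 - r) * (a * u + b * v)
          = (u - v) * (a + (r - 1) * b) + (v - (r - 1) * u) * (a + b) := by ring
      have e2 : (u - v) * M + (v - (r - 1) * u) * (r * M) = (r - 1) * M * (u + v) := by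
        linear_combination (-u * M) * hr
      have i3 : (r - 1) * M * (u + v) ≤ (r - 1) * M * r :=
        mul_le_mul_of_nonneg_left hs (mul_nonneg (by linarith) hM)
      have e3 : (r - 1) * M * r = (2 - r) * M := by linear_combination M * hr
      refine le_of_mul_le_mul_left (?_ : (2 - r) * _ ≤ (2 - r) * M) (by linarith)
      linarith
  rw [abs_le]
  constructor
  · have := key (-a) (-b) (by linarith) (by linarith) (by linarith)
    linarith
  · exact key a b ha.2 hc.2 hd.2

lemma bddAbove_abs_linear_image_sector (A B : ℝ) :
    BddAbove ((fun q : ℝ × ℝ => |A * q.1 + B * q.2|) '' sector) := by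
  refine ⟨|A| + |B|, ?_⟩
  rintro _ ⟨⟨u, v⟩, ⟨hv, hvu, huv⟩, rfl⟩
  simp only at hv hvu huv ⊢
  have hu1 : u ≤ 1 := by nlinarith
  calc |A * u + B * v| ≤ |A * u| + |B * v| := abs_add_le _ _
    _ = |A| * u + |B| * v := by
        rw [abs_mul, abs_mul, abs_of_nonneg hv, abs_of_nonneg (hv.trans hvu)]
    _ ≤ |A| + |B| := by
        nlinarith [abs_nonneg A, abs_nonneg B,
          mul_le_mul_of_nonneg_left hu1 (abs_nonneg A),
          mul_le_mul_of_nonneg_left (hvu.trans hu1) (abs_nonneg B)]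

/-- Reduction of the supremum over the family to bounds in `t = √(2(1+s))` and `l = y/x`. -/
lemma sSup_diffNorm_eq_s16 {r x l m t₀ : ℝ} (hr0 : 0 < r) (hr : r ^ 2 = 2) (hx : 0 < x)
    (H : ∀ t, 2 ≤ t → t ≤ 2 + 2 * r → |2 * t * l - 2| ≤ m ∧
      |2 * t * l - 2 + (r - 1) * (2 * t - (t ^ 2 - 2) * l)| ≤ m ∧
      |2 * t * l - 2 + (2 * t - (t ^ 2 - 2) * l)| ≤ r * m)
    (ht : 2 ≤ t₀) (ht' : t₀ ≤ 2 + 2 * r)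
    (H' : m ≤ 2 * t₀ * l - 2 ∨ r * m ≤ 2 * t₀ * l - 2 + (2 * t₀ - (t₀ ^ 2 - 2) * l)) :
    sSup {q : ℝ | ∃ s ∈ Set.Icc (1 : ℝ) (5 + 4 * r),
        q = diffNorm 1 s (-2 * Real.sqrt (2 * (1 + s))) x (l * x)} = m * x := by
  have ne : sector.Nonempty := ⟨(0, 0), by simp [sector]⟩
  have upper : ∀ s ∈ Set.Icc (1 : ℝ) (5 + 4 * r),
      diffNorm 1 s (-2 * Real.sqrt (2 * (1 + s))) x (l * x) ≤ m * x := by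
    rintro s ⟨hs1, hs2⟩
    have hsq := Real.sq_sqrt (show (0 : ℝ) ≤ 2 * (1 + s) by linarith)
    have ht0 := Real.sqrt_nonneg (2 * (1 + s))
    set t := Real.sqrt (2 * (1 + s))
    have h2 : 2 ≤ t := by nlinarith
    have h3 : t ≤ 2 + 2 * r := by nlinarith
    obtain ⟨i1, i2, i3⟩ := H t h2 h3
    unfold diffNorm
    apply csSup_le (ne.image _)
    rintro _ ⟨p, hp, rfl⟩
    have hb := abs_linear_le_of_mem_sector hr0 hr i1 i2 i3 hp
    have e : (2 * 1 * x + -2 * t * (l * x)) * p.1 + (2 * s * (l * x) + -2 * t * x) * p.2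
        = -(((2 * t * l - 2) * p.1 + (2 * t - (t ^ 2 - 2) * l) * p.2) * x) := by
      linear_combination (-l * x * p.2) * hsq
    simp only
    rw [e, abs_neg, abs_mul, abs_of_pos hx]
    exact mul_le_mul_of_nonneg_right hb hx.le
  have hs₀ : t₀ ^ 2 / 2 - 1 ∈ Set.Icc (1 : ℝ) (5 + 4 * r) := ⟨by nlinarith, by nlinarith⟩
  apply IsGreatest.csSup_eq
  refine ⟨⟨t₀ ^ 2 / 2 - 1, hs₀, ?_⟩, ?_⟩
  · apply le_antisymm _ (upper _ hs₀)
    have e : Real.sqrt (2 * (1 + (t₀ ^ 2 / 2 - 1))) = t₀ := by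
      rw [show 2 * (1 + (t₀ ^ 2 / 2 - 1)) = t₀ ^ 2 by ring, Real.sqrt_sq (by linarith)]
    rw [e]
    unfold diffNorm
    rcases H' with h | h
    · refine le_csSup_of_le (bddAbove_abs_linear_image_sector _ _)
        ⟨(1, 0), by simp [sector], rfl⟩ ?_
      refine le_trans ?_ (neg_le_abs _)
      simp only
      nlinarith [mul_le_mul_of_nonneg_right h hx.le]
    · refine le_csSup_of_le (bddAbove_abs_linear_image_sector _ _)
        ⟨(r / 2, r / 2), ⟨by simp only; linarith, le_rfl, by simp only; nlinarith⟩, rfl⟩ ?_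
      refine le_trans ?_ (neg_le_abs _)
      simp only
      have h2 := mul_le_mul_of_nonneg_right h (mul_pos hr0 hx).le
      have e2 : r * m * (r * x) = 2 * (m * x) := by linear_combination m * x * hr
      linarith
  · rintro _ ⟨s, hs, rfl⟩
    exact upper s hs

section Estimates

variable {r l t : ℝ}

lemma neg_corner_value_le (hr0 : 0 < r) (hr : r ^ 2 = 2) (hl : 0 ≤ l) (ht : 2 ≤ t)
    (ht' : t ≤ 2 + 2 * r) :
    -(2 * t * l - 2 + (r - 1) * (2 * t - (t ^ 2 - 2) * l)) ≤ 1 := by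
  have hr1 : 1.4 < r := by nlinarith
  have h1 : 0 ≤ (r - 1) * l * t * (2 + 2 * r - t) :=
    mul_nonneg (mul_nonneg (mul_nonneg (by linarith) hl) (by linarith)) (by linarith)
  have h2 : 0 ≤ (r - 1) * l := mul_nonneg (by linarith) hl
  have h3 : 0 ≤ (r - 1) * (t - 2) := mul_nonneg (by linarith) (by linarith)
  have e : 2 * t * l - 2 + (r - 1) * (2 * t - (t ^ 2 - 2) * l)
      = -2 + 2 * ((r - 1) * (t - 2)) + 4 * (r - 1) + 2 * ((r - 1) * l)
        + (r - 1) * l * t * (2 + 2 * r - t) := by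
    linear_combination (-2 * l * t) * hr
  rw [e]
  linarith

lemma corner_value_mul (hr : r ^ 2 = 2) :
    l * (2 * t * l - 2 + (r - 1) * (2 * t - (t ^ 2 - 2) * l))
      = (3 * r - 1) * l ^ 2 + (r - 1) - (r - 1) * (l * t - 1 - (r + 1) * l) ^ 2 := by
  linear_combination (-2 * l ^ 2 * t + 2 * l + (r + 1) * l ^ 2) * hr

lemma diagonal_value_mul :
    l * (2 * t * l - 2 + (2 * t - (t ^ 2 - 2) * l))
      = 1 + 3 * l ^ 2 - (l * t - 1 - l) ^ 2 := by
  ring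

lemma neg_diagonal_value_le (hl : 0 ≤ l) (ht : 2 ≤ t) (ht' : t ≤ 2 + 2 * r) :
    -(2 * t * l - 2 + (2 * t - (t ^ 2 - 2) * l)) ≤ t * (2 * r * l - 2) + 2 - 2 * l := by
  have h1 : 0 ≤ l * t * (2 + 2 * r - t) :=
    mul_nonneg (mul_nonneg hl (by linarith)) (by linarith)
  nlinarith

lemma estimates_of_small (hr0 : 0 < r) (hr : r ^ 2 = 2) (hl : 0 ≤ l)
    (h : (1 + 2 * r) * l < 1) (ht : 2 ≤ t) (ht' : t ≤ 2 + 2 * r) :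
    |2 * t * l - 2| ≤ r * ((1 + 2 * r) - (3 + 2 * r) * l) ∧
      |2 * t * l - 2 + (r - 1) * (2 * t - (t ^ 2 - 2) * l)|
        ≤ r * ((1 + 2 * r) - (3 + 2 * r) * l) ∧
      |2 * t * l - 2 + (2 * t - (t ^ 2 - 2) * l)|
        ≤ r * (r * ((1 + 2 * r) - (3 + 2 * r) * l)) := by
  have hr1 : 1.414 < r := by nlinarith
  have hr2 : r < 1.4143 := by nlinarith
  have hl1 : l < 0.262 := by nlinarith
  have em : r * ((1 + 2 * r) - (3 + 2 * r) * l) = r + 4 - (3 * r + 4) * l := by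
    linear_combination (2 - 2 * l) * hr
  have em2 : r * (r * ((1 + 2 * r) - (3 + 2 * r) * l)) = 2 + 4 * r - (6 + 4 * r) * l := by
    rw [em]; linear_combination (1 - 3 * l) * hr
  have hrl : r * l ≤ 1.4143 * l := mul_le_mul_of_nonneg_right hr2.le hl
  have htl : t * l ≤ (2 + 2 * r) * l := mul_le_mul_of_nonneg_right ht' hl
  have htl0 : 0 ≤ t * l := mul_nonneg (by linarith) hl
  have hn := neg_corner_value_le hr0 hr hl ht ht'
  have hn' := neg_diagonal_value_le hl ht ht'
  rw [em2, em]
  refine ⟨abs_le.2 ⟨by linarith, by linarith⟩, abs_le.2 ⟨by linarith, ?_⟩,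
    abs_le.2 ⟨?_, ?_⟩⟩
  · have h1 : 0 ≤ (2 + 2 * r - t) * (2 * (r - 1) - 2 * l) :=
      mul_nonneg (by linarith) (by linarith)
    have h2 : 0 ≤ (r - 1) * l * (2 + 2 * r - t) ^ 2 :=
      mul_nonneg (mul_nonneg (by linarith) hl) (sq_nonneg _)
    have e : 2 * t * l - 2 + (r - 1) * (2 * t - (t ^ 2 - 2) * l)
        = 2 + 2 * (r - 1) * l - (2 + 2 * r - t) * (2 * (r - 1) - 2 * l)
          - (r - 1) * l * (2 + 2 * r - t) ^ 2 := by
      linear_combination (4 + 4 * r * l - 4 * t * l + 4 * l) * hr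
    rw [e]
    linarith
  · have h1 : 0 ≤ (t - 2) * (1 - r * l) := mul_nonneg (by linarith) (by linarith)
    nlinarith
  · have h1 : 0 ≤ (2 + 2 * r - t) * (2 - (2 + 4 * r) * l) :=
      mul_nonneg (by linarith) (by linarith)
    have h2 : 0 ≤ l * (2 + 2 * r - t) ^ 2 := mul_nonneg hl (sq_nonneg _)
    nlinarith

lemma estimates_of_medium (hr0 : 0 < r) (hr : r ^ 2 = 2) (hl : 0 < l) (hl' : l < 0.467)
    (h : (8 + 5 * r) * l ^ 2 - 4 * l - r ≤ 0) (ht : 2 ≤ t) (ht' : t ≤ 2 + 2 * r) :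
    |2 * t * l - 2| ≤ r * (1 + 3 * l ^ 2) / (2 * l) ∧
      |2 * t * l - 2 + (r - 1) * (2 * t - (t ^ 2 - 2) * l)|
        ≤ r * (1 + 3 * l ^ 2) / (2 * l) ∧
      |2 * t * l - 2 + (2 * t - (t ^ 2 - 2) * l)| ≤ r * (r * (1 + 3 * l ^ 2) / (2 * l)) := by
  have hr1 : 1.414 < r := by nlinarith
  have hr2 : r < 1.4143 := by nlinarith
  have em : l * (r * (1 + 3 * l ^ 2) / (2 * l)) = r * (1 + 3 * l ^ 2) / 2 := by
    field_simp
  set m := r * (1 + 3 * l ^ 2) / (2 * l)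
  have hlm : 0.7 * (1 + 3 * l ^ 2) ≤ l * m := by rw [em]; nlinarith [sq_nonneg l]
  have hm : 1 ≤ m := by
    refine le_of_mul_le_mul_left (?_ : l * 1 ≤ l * m) hl
    nlinarith
  have hrm : 0 ≤ r * m := by positivity
  have htl : t * l ≤ (2 + 2 * r) * l := mul_le_mul_of_nonneg_right ht' hl.le
  have htl' : 2 * l ≤ t * l := mul_le_mul_of_nonneg_right ht hl.le
  have hrl : r * l ≤ 1.4143 * l := mul_le_mul_of_nonneg_right hr2.le hl.le
  have hn := neg_corner_value_le hr0 hr hl.le ht ht'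
  have hn' := neg_diagonal_value_le hl.le ht ht'
  refine ⟨abs_le.2 ⟨?_, ?_⟩, abs_le.2 ⟨by linarith, ?_⟩, abs_le.2 ⟨?_, ?_⟩⟩
  · have : 2 - 4 * l ≤ m := by
      refine le_of_mul_le_mul_left (?_ : l * (2 - 4 * l) ≤ l * m) hl
      nlinarith [sq_nonneg (l - 0.33)]
    linarith
  · have : 4 * (1 + r) * l - 2 ≤ m := by
      refine le_of_mul_le_mul_left (?_ : l * (4 * (1 + r) * l - 2) ≤ l * m) hl
      rw [em]
      linarith
    linarith
  · refine le_of_mul_le_mul_left (?_ : l * _ ≤ l * m) hl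
    rw [corner_value_mul hr, em]
    have h1 : 0 ≤ (r - 1) * (l * t - 1 - (r + 1) * l) ^ 2 :=
      mul_nonneg (by linarith) (sq_nonneg _)
    have h2 : (3 / 2 * r - 1) * l ^ 2 ≤ 1 - r / 2 := by
      have : l ^ 2 ≤ 0.219 := by nlinarith
      nlinarith
    linarith
  · have h1 : 0 ≤ (t - 2) * (1 - r * l) := mul_nonneg (by linarith) (by linarith)
    nlinarith
  · refine le_of_mul_le_mul_left (?_ : l * _ ≤ l * (r * m)) hl
    have : l * (r * m) = 1 + 3 * l ^ 2 := by
      rw [mul_left_comm, em]; linear_combination (1 + 3 * l ^ 2) / 2 * hr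
    rw [diagonal_value_mul, this]
    linarith [sq_nonneg (l * t - 1 - l)]

lemma estimates_of_large (hr0 : 0 < r) (hr : r ^ 2 = 2) (hl : 0.466 < l)
    (h : 0 ≤ (8 + 5 * r) * l ^ 2 - 4 * l - r) (ht : 2 ≤ t) (ht' : t ≤ 2 + 2 * r) :
    |2 * t * l - 2| ≤ 4 * (1 + r) * l - 2 ∧
      |2 * t * l - 2 + (r - 1) * (2 * t - (t ^ 2 - 2) * l)| ≤ 4 * (1 + r) * l - 2 ∧
      |2 * t * l - 2 + (2 * t - (t ^ 2 - 2) * l)| ≤ r * (4 * (1 + r) * l - 2) := by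
  have hr1 : 1.414 < r := by nlinarith
  have hr2 : r < 1.4143 := by nlinarith
  have hl0 : 0 < l := by linarith
  have htl : t * l ≤ (2 + 2 * r) * l := mul_le_mul_of_nonneg_right ht' hl0.le
  have htl' : 2 * l ≤ t * l := mul_le_mul_of_nonneg_right ht hl0.le
  have hrl : 1.414 * l ≤ r * l := mul_le_mul_of_nonneg_right hr1.le hl0.le
  have hn := neg_corner_value_le hr0 hr hl0.le ht ht'
  have hn' := neg_diagonal_value_le hl0.le ht ht'
  have em : r * (4 * (1 + r) * l - 2) = (4 * r + 8) * l - 2 * r := by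
    linear_combination 4 * l * hr
  refine ⟨abs_le.2 ⟨by linarith, by linarith⟩, abs_le.2 ⟨by linarith, ?_⟩,
    abs_le.2 ⟨?_, ?_⟩⟩
  · refine le_of_mul_le_mul_left (?_ : l * _ ≤ l * _) hl0
    rw [corner_value_mul hr]
    have h1 : 0 ≤ (r - 1) * (l * t - 1 - (r + 1) * l) ^ 2 :=
      mul_nonneg (by linarith) (sq_nonneg _)
    have h2 : 0 ≤ (5 + r) * l ^ 2 - 2 * l - (r - 1) := by
      nlinarith [mul_nonneg (sub_nonneg.2 hr1.le) (sq_nonneg l),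
        mul_nonneg (sub_nonneg.2 hl.le) (sub_nonneg.2 hl.le)]
    linarith
  · rw [em]
    rcases le_total (r * l) 1 with h1 | h1
    · have h2 : 0 ≤ (t - 2) * (1 - r * l) := mul_nonneg (by linarith) (by linarith)
      nlinarith
    · have h2 : 0 ≤ (2 + 2 * r - t) * (r * l - 1) := mul_nonneg (by linarith) (by linarith)
      have e : (2 + 2 * r) * (r * l - 1) = (2 * r + 4) * l - 2 - 2 * r := by
        linear_combination 2 * l * hr
      linarith
  · refine le_of_mul_le_mul_left (?_ : l * _ ≤ l * _) hl0
    rw [diagonal_value_mul, em]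
    have h1 : 0 ≤ r * ((8 + 5 * r) * l ^ 2 - 4 * l - r) := mul_nonneg hr0.le h
    have e : r * ((8 + 5 * r) * l ^ 2 - 4 * l - r)
        = 2 * (l * ((4 * r + 8) * l - 2 * r) - (1 + 3 * l ^ 2)) := by
      linear_combination (5 * l ^ 2 - 1) * hr
    linarith [sq_nonneg (l * t - 1 - l)]

end Estimates

theorem stmt_16 (x y : ℝ) (hxy : (x, y) ∈ sector) (hx : 0 < x) :
    sSup {r : ℝ | ∃ s ∈ Set.Icc (1 : ℝ) (5 + 4 * Real.sqrt 2),
        r = diffNorm 1 s (-2 * Real.sqrt (2 * (1 + s))) x y} =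
      if y / x < (2 * Real.sqrt 2 - 1) / 7 then
        Real.sqrt 2 * ((1 + 2 * Real.sqrt 2) * x - (3 + 2 * Real.sqrt 2) * y)
      else if y / x < ((4 * Real.sqrt 2 - 5) * Real.sqrt (4 * Real.sqrt 2 + 7)
          + 8 - 5 * Real.sqrt 2) / 7 then
        Real.sqrt 2 * (x ^ 2 + 3 * y ^ 2) / (2 * y)
      else
        4 * (1 + Real.sqrt 2) * y - 2 * x := by
  obtain ⟨hy0, hyx, -⟩ := hxy
  simp only at hy0 hyx
  have hr := Real.sq_sqrt (show (0 : ℝ) ≤ 2 by norm_num)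
  have hr0 : 0 < Real.sqrt 2 := by positivity
  set r := Real.sqrt 2
  have hr1 : 1.4142 < r := by nlinarith
  have hr2 : r < 1.41422 := by nlinarith
  obtain ⟨l, rfl⟩ : ∃ l, y = l * x := ⟨y / x, by field_simp⟩
  have hl0 : 0 ≤ l := nonneg_of_mul_nonneg_left hy0 hx
  have hl1 : l ≤ 1 := by nlinarith
  rw [mul_div_cancel_right₀ l hx.ne']
  have hw := Real.sq_sqrt (show (0 : ℝ) ≤ 4 * r + 7 by linarith)
  have hw0 := Real.sqrt_nonneg (4 * r + 7)
  set w := Real.sqrt (4 * r + 7)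
  have hw1 : 3.5575 < w := by nlinarith
  have hw2 : w < 3.5577 := by nlinarith
  set l₁ := ((4 * r - 5) * w + 8 - 5 * r) / 7 with hl₁
  have root : (8 + 5 * r) * l₁ ^ 2 - 4 * l₁ - r = 0 := by
    have e : (8 + 5 * r) * l₁ = 2 + r * w := by
      rw [hl₁]; linear_combination (20 * w - 25) / 7 * hr
    have e2 : (8 + 5 * r) * ((8 + 5 * r) * l₁ ^ 2 - 4 * l₁ - r) = 0 := by
      linear_combination ((8 + 5 * r) * l₁ + r * w - 2) * e + r ^ 2 * hw + (4 * r + 2) * hr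
    exact (mul_eq_zero.1 e2).resolve_left (by positivity)
  have hl₁a : 0.466 < l₁ := by rw [hl₁]; nlinarith
  have hl₁b : l₁ < 0.467 := by rw [hl₁]; nlinarith
  have factor : (8 + 5 * r) * l ^ 2 - 4 * l - r
      = (l - l₁) * ((8 + 5 * r) * (l + l₁) - 4) := by
    linear_combination root
  have hpos : 0 ≤ (8 + 5 * r) * (l + l₁) - 4 := by nlinarith
  split_ifs with h1 h2
  · rw [sSup_diffNorm_eq_s16 (t₀ := 2 + 2 * r) hr0 hr hx
      (fun t => estimates_of_small hr0 hr hl0 (by nlinarith)) (by linarith) le_rfl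
      (Or.inr (le_of_eq ?_))]
    · ring
    · linear_combination ((1 + 2 * r) - (3 + 2 * r) * l + 4 * l) * hr
  · push Not at h1
    have hl : 0 < l := by linarith
    have hl2 : 1 ≤ (1 + 2 * r) * l := by nlinarith
    rw [sSup_diffNorm_eq_s16 (t₀ := 1 + 1 / l) hr0 hr hx
      (fun t => estimates_of_medium hr0 hr hl (by linarith)
        (by rw [factor]; exact mul_nonpos_of_nonpos_of_nonneg (by linarith) hpos))
      ?_ ?_ (Or.inr (le_of_eq ?_))]
    · field_simp
    · have : 1 ≤ 1 / l := by rw [le_div_iff₀ hl]; linarith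
      linarith
    · have : 1 / l ≤ 1 + 2 * r := by rw [div_le_iff₀ hl]; exact hl2
      linarith
    · field_simp
      linear_combination (1 + 3 * l ^ 2) * hr
  · push Not at h2
    rw [sSup_diffNorm_eq_s16 (t₀ := 2 + 2 * r) hr0 hr hx
      (fun t => estimates_of_large hr0 hr (by linarith)
        (by rw [factor]; exact mul_nonneg (by linarith) hpos)) (by linarith) le_rfl
      (Or.inl (le_of_eq ?_))]
    · ring
    · ring
end
end
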